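/- Let G be a group, B ≤ G a subgroup, and 1 → R → Q → S → 1 a central extension of G-groups. Suppose: the restriction maps H^1(G,R) → H^1(B,R) and H^1(G,S) → H^1(B,S) are bijective; the restriction map H^2(G,R) → H^2(B,R) is injective; and for every γ ∈ Z^1(G,S), writing β = γ|_B, the restriction map (S_γ)^G → (S_β)^B on twisted fixed points is surjective. Then the restriction map H^1(G,Q) → H^1(B,Q) is a bijection. -/

import Mathlib

/-- A right action of a group `G` on a group `Q` by group automorphisms,
written `q ↦ q^g` in the paper; here `act q g`. -/
structure GAction (G : Type*) (Q : Type*) [Group G] [Group Q] where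
  act : Q → G → Q
  act_one : ∀ q, act q 1 = q
  act_mul : ∀ q g h, act (act q g) h = act q (g * h)
  act_map_mul : ∀ g q q', act (q * q') g = act q g * act q' g

namespace GAction

variable {G Q : Type*} [Group G] [Group Q]

/-- `γ : G → Q` is a 1-cocycle: `γ(gh) = γ(g)^h · γ(h)`. -/
def IsCocycle (A : GAction G Q) (γ : G → Q) : Prop :=
  ∀ g h : G, γ (g * h) = A.act (γ g) h * γ h

/-- Two 1-cochains are cohomologous: `δ(g) = (q^g)⁻¹ · γ(g) · q` for some `q`. -/
def Cohomologous (A : GAction G Q) (γ δ : G → Q) : Prop :=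
  ∃ q : Q, ∀ g : G, δ g = (A.act q g)⁻¹ * γ g * q

/-- `τ : G × G → Q` is a 2-cocycle: `τ(g,h)^k · τ(gh,k) = τ(h,k) · τ(g,hk)`. -/
def IsTwoCocycle (A : GAction G Q) (τ : G → G → Q) : Prop :=
  ∀ g h k : G, A.act (τ g h) k * τ (g * h) k = τ h k * τ g (h * k)

/-- Two 2-cochains are cohomologous:
`τ'(g,h) = τ(g,h) · φ(g)^h · φ(h) · φ(gh)⁻¹` for some `φ : G → Q`. -/
def TwoCohomologous (A : GAction G Q) (τ τ' : G → G → Q) : Prop :=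
  ∃ φ : G → Q, ∀ g h : G, τ' g h = τ g h * A.act (φ g) h * φ h * (φ (g * h))⁻¹

/-- The restriction of a `G`-action to a subgroup `B ≤ G`. -/
def res (A : GAction G Q) (B : Subgroup G) : GAction B Q where
  act q b := A.act q (b : G)
  act_one q := by simpa using A.act_one q
  act_mul q b c := by simpa using A.act_mul q (b : G) (c : G)
  act_map_mul b q q' := A.act_map_mul (b : G) q q'

end GAction

/-- `1 → R →(ι) Q →(π) S → 1` is a central extension of `G`-groups. -/
structure IsCentralExt {G R Q S : Type*} [Group G] [Group R] [Group Q] [Group S]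
    (AR : GAction G R) (AQ : GAction G Q) (AS : GAction G S)
    (ι : R →* Q) (π : Q →* S) : Prop where
  ι_inj : Function.Injective ι
  π_surj : Function.Surjective π
  exact : ∀ q : Q, π q = 1 ↔ ∃ r : R, ι r = q
  ι_equiv : ∀ (r : R) (g : G), ι (AR.act r g) = AQ.act (ι r) g
  π_equiv : ∀ (q : Q) (g : G), π (AQ.act q g) = AS.act (π q) g
  central : ∀ (r : R) (q : Q), ι r * q = q * ι r

namespace GAction

variable {G Q : Type*} [Group G] [Group Q]

/-- The automorphism `q ↦ q^g` as a monoid homomorphism. -/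
def actHom (A : GAction G Q) (g : G) : Q →* Q :=
  MonoidHom.mk' (fun q => A.act q g) (A.act_map_mul g)

theorem act_inv (A : GAction G Q) (g : G) (q : Q) : A.act q⁻¹ g = (A.act q g)⁻¹ :=
  map_inv (A.actHom g) q

theorem one_act (A : GAction G Q) (g : G) : A.act 1 g = 1 :=
  map_one (A.actHom g)

/-- Twisting a cocycle by a coboundary gives a cocycle. -/
theorem IsCocycle.twist {A : GAction G Q} {γ : G → Q} (hγ : A.IsCocycle γ) (q : Q) :
    A.IsCocycle (fun g => (A.act q g)⁻¹ * γ g * q) := by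
  intro g h
  simp only [hγ g h, A.act_map_mul, act_inv, A.act_mul]
  group

end GAction

namespace IsCentralExt

variable {G R Q S : Type*} [Group G] [Group R] [Group Q] [Group S]
  {AR : GAction G R} {AQ : GAction G Q} {AS : GAction G S} {ι : R →* Q} {π : Q →* S}

theorem mul_comm (hE : IsCentralExt AR AQ AS ι π) (r s : R) : r * s = s * r :=
  hE.ι_inj (by rw [map_mul, map_mul, hE.central])

/-- Elements of `Q` with the same image in `S` differ by an element of `R`. -/
theorem exists_ι_mul (hE : IsCentralExt AR AQ AS ι π) {p q : Q} (h : π p = π q) :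
    ∃ r, p = ι r * q := by
  obtain ⟨r, hr⟩ := (hE.exact (p * q⁻¹)).1 (by simp [h])
  exact ⟨r, by simp [hr]⟩

theorem isCocycle_π (hE : IsCentralExt AR AQ AS ι π) {γ : G → Q} (hγ : AQ.IsCocycle γ) :
    AS.IsCocycle (fun g => π (γ g)) := by
  intro g h
  simp only [hγ g h, map_mul, hE.π_equiv]

/-- The restriction of a central extension of `G`-groups to a subgroup. -/
theorem res (hE : IsCentralExt AR AQ AS ι π) (B : Subgroup G) :
    IsCentralExt (AR.res B) (AQ.res B) (AS.res B) ι π :=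
  ⟨hE.ι_inj, hE.π_surj, hE.exact, fun r g => hE.ι_equiv r g, fun q g => hE.π_equiv q g,
    hE.central⟩

/-- Multiplying a cocycle in `Q` by a cochain in `R` gives a cocycle exactly when the cochain is
a cocycle. -/
theorem isCocycle_ι_mul_iff (hE : IsCentralExt AR AQ AS ι π) {ρ : G → R} {γ : G → Q}
    (hγ : AQ.IsCocycle γ) : AQ.IsCocycle (fun g => ι (ρ g) * γ g) ↔ AR.IsCocycle ρ := by
  have key : ∀ g h : G, AQ.act (ι (ρ g) * γ g) h * (ι (ρ h) * γ h)
      = ι (AR.act (ρ g) h * ρ h) * γ (g * h) := by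
    intro g h
    rw [hγ g h, AQ.act_map_mul, map_mul, hE.ι_equiv]
    calc _ = AQ.act (ι (ρ g)) h * (AQ.act (γ g) h * ι (ρ h)) * γ h := by simp only [mul_assoc]
      _ = _ := by rw [← hE.central]; simp only [mul_assoc]
  refine forall_congr' fun g => forall_congr' fun h => ?_
  rw [key, mul_left_inj, hE.ι_inj.eq_iff]

/-- The connecting cocycle: a lift of a cocycle in `S` to a cochain in `Q` fails to be a cocycle
by a 2-cocycle in `R`. -/
theorem exists_isTwoCocycle (hE : IsCentralExt AR AQ AS ι π) {c : G → Q}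
    (hc : AS.IsCocycle (fun g => π (c g))) :
    ∃ τ : G → G → R, AR.IsTwoCocycle τ ∧
      ∀ g h, AQ.act (c g) h * c h = ι (τ g h) * c (g * h) := by
  have H : ∀ g h, ∃ r, AQ.act (c g) h * c h = ι r * c (g * h) := fun g h =>
    hE.exists_ι_mul (by simpa only [map_mul, hE.π_equiv] using (hc g h).symm)
  choose τ hτ using H
  refine ⟨τ, fun g h k => hE.ι_inj ?_, hτ⟩
  apply mul_right_cancel (b := c (g * h * k))
  calc ι (AR.act (τ g h) k * τ (g * h) k) * c (g * h * k)
      = AQ.act (ι (τ g h)) k * (ι (τ (g * h) k) * c (g * h * k)) := by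
        rw [map_mul, hE.ι_equiv, mul_assoc]
    _ = AQ.act (AQ.act (c g) h * c h) k * c k := by
        rw [← hτ, hτ g h, AQ.act_map_mul, mul_assoc]
    _ = AQ.act (c g) (h * k) * ι (τ h k) * c (h * k) := by
        rw [AQ.act_map_mul, AQ.act_mul, mul_assoc, hτ, mul_assoc]
    _ = ι (τ h k * τ g (h * k)) * c (g * h * k) := by
        rw [← hE.central, mul_assoc, hτ, map_mul, mul_assoc, mul_assoc g h k]

end IsCentralExt

/-- five lemma for `H¹`, bijectivity. Let `B ≤ G` and let
`1 → R → Q → S → 1` be a central extension of `G`-groups. If the restriction maps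
`H¹(G,R) → H¹(B,R)` and `H¹(G,S) → H¹(B,S)` are bijective, `H²(G,R) → H²(B,R)` is
injective, and for every `γ ∈ Z¹(G,S)` (with `β = γ|_B`) the restriction map
`(S_γ)^G → (S_β)^B` on twisted fixed points is surjective, then
`H¹(G,Q) → H¹(B,Q)` is a bijection. -/
theorem five_lemma_h1_bijective
    {G R Q S : Type*} [Group G] [Group R] [Group Q] [Group S]
    (AR : GAction G R) (AQ : GAction G Q) (AS : GAction G S)
    (ι : R →* Q) (π : Q →* S)
    (hCE : IsCentralExt AR AQ AS ι π) (B : Subgroup G)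
    -- `H¹(G,R) → H¹(B,R)` surjective
    (h2s : ∀ β : B → R, (AR.res B).IsCocycle β →
      ∃ γ : G → R, AR.IsCocycle γ ∧ (AR.res B).Cohomologous (fun b => γ (b : G)) β)
    -- `H¹(G,R) → H¹(B,R)` injective
    (h2i : ∀ γ δ : G → R, AR.IsCocycle γ → AR.IsCocycle δ →
      (AR.res B).Cohomologous (fun b => γ (b : G)) (fun b => δ (b : G)) →
      AR.Cohomologous γ δ)
    -- `H¹(G,S) → H¹(B,S)` surjective
    (h4s : ∀ β : B → S, (AS.res B).IsCocycle β →
      ∃ γ : G → S, AS.IsCocycle γ ∧ (AS.res B).Cohomologous (fun b => γ (b : G)) β)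
    -- `H¹(G,S) → H¹(B,S)` injective
    (h4i : ∀ γ δ : G → S, AS.IsCocycle γ → AS.IsCocycle δ →
      (AS.res B).Cohomologous (fun b => γ (b : G)) (fun b => δ (b : G)) →
      AS.Cohomologous γ δ)
    -- `H²(G,R) → H²(B,R)` injective
    (h5 : ∀ τ τ' : G → G → R, AR.IsTwoCocycle τ → AR.IsTwoCocycle τ' →
      (AR.res B).TwoCohomologous (fun b c => τ (b : G) (c : G))
        (fun b c => τ' (b : G) (c : G)) →
      AR.TwoCohomologous τ τ')
    -- for every `γ ∈ Z¹(G,S)`, the inclusion `(S_γ)^G ⊆ (S_{γ|_B})^B` is onto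
    (hfix : ∀ γ : G → S, AS.IsCocycle γ → ∀ s : S,
      (∀ b : B, (γ (b : G))⁻¹ * AS.act s (b : G) * γ (b : G) = s) →
      ∀ g : G, (γ g)⁻¹ * AS.act s g * γ g = s) :
    -- `H¹(G,Q) → H¹(B,Q)` is a bijection
    (∀ β : B → Q, (AQ.res B).IsCocycle β →
      ∃ γ : G → Q, AQ.IsCocycle γ ∧ (AQ.res B).Cohomologous (fun b => γ (b : G)) β)
    ∧ (∀ γ δ : G → Q, AQ.IsCocycle γ → AQ.IsCocycle δ →
      (AQ.res B).Cohomologous (fun b => γ (b : G)) (fun b => δ (b : G)) →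
      AQ.Cohomologous γ δ) := by
  constructor
  · intro β hβ
    obtain ⟨γ, hγ, s, hs⟩ := h4s _ ((hCE.res B).isCocycle_π hβ)
    have hlift : ∀ g : G, ∃ q : Q, π q = (AS.act s g)⁻¹ * γ g * s ∧
        ∀ hg : g ∈ B, q = β ⟨g, hg⟩ := by
      intro g
      by_cases hg : g ∈ B
      · exact ⟨β ⟨g, hg⟩, hs ⟨g, hg⟩, fun _ => rfl⟩
      · obtain ⟨q, hq⟩ := hCE.π_surj ((AS.act s g)⁻¹ * γ g * s)
        exact ⟨q, hq, fun h => absurd h hg⟩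
    choose c hcπ hcB using hlift
    have hcβ : ∀ b : B, c b = β b := fun b => hcB b b.2
    obtain ⟨τ, hτ, hcτ⟩ := hCE.exists_isTwoCocycle (c := c)
      (by simpa only [hcπ] using hγ.twist s)
    have hτB : ∀ b d : B, τ b d = 1 := by
      intro b d
      have h := hcτ b d
      rw [hcβ, hcβ, ← Subgroup.coe_mul, hcβ, hβ b d] at h
      exact hCE.ι_inj ((right_eq_mul.1 h).trans (map_one ι).symm)
    obtain ⟨φ, hφ⟩ := h5 τ (fun _ _ => 1) hτ (fun g h k => by simp [AR.one_act])
      ⟨fun _ => 1, fun b d => by simp [hτB, GAction.one_act]⟩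
    have hφ' : ∀ g h, φ (g * h) = τ g h * AR.act (φ g) h * φ h := fun g h =>
      (mul_inv_eq_one.1 (hφ g h).symm).symm
    have hcφ : AQ.IsCocycle (fun g => ι (φ g) * c g) := by
      intro g h
      calc ι (φ (g * h)) * c (g * h)
          = ι (AR.act (φ g) h) * ι (φ h) * (ι (τ g h) * c (g * h)) := by
            rw [hφ', mul_assoc (τ g h), hCE.mul_comm (τ g h), map_mul, map_mul, mul_assoc]
        _ = AQ.act (ι (φ g)) h * (ι (φ h) * AQ.act (c g) h) * c h := by
            rw [← hcτ, hCE.ι_equiv]; simp only [mul_assoc]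
        _ = AQ.act (ι (φ g) * c g) h * (ι (φ h) * c h) := by
            rw [hCE.central, AQ.act_map_mul]; simp only [mul_assoc]
    obtain ⟨ψ, hψ, r, hr⟩ := h2s (fun b => φ b) (fun b d => by
      have h := hφ' b d
      rwa [hτB, one_mul] at h)
    have hψ' : AR.IsCocycle (fun g => (ψ g)⁻¹) := fun g h => by
      simp only [hψ g h, mul_inv_rev, AR.act_inv]
      exact hCE.mul_comm _ _
    refine ⟨_, (hCE.isCocycle_ι_mul_iff hcφ).2 hψ', ι r⁻¹, fun b => ?_⟩
    have hr' : φ b = (AR.act r b)⁻¹ * ψ b * r := hr b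
    change β b = (AQ.act (ι r⁻¹) b)⁻¹ * (ι (ψ b)⁻¹ * (ι (φ b) * c b)) * ι r⁻¹
    rw [mul_assoc, ← hCE.central, ← hCE.ι_equiv, AR.act_inv, ← map_inv, inv_inv, hcβ]
    simp only [← mul_assoc, ← map_mul]
    rw [hr', mul_assoc _ (ψ b) r, hCE.mul_comm _ (ψ b * r), right_eq_mul,
      map_eq_one_iff ι hCE.ι_inj]
    group
  · rintro γ δ hγ hδ ⟨q, hq⟩
    have hq' : ∀ b : B, δ b = (AQ.act q b)⁻¹ * γ b * q := hq
    have hπB : ∀ b : B, π (δ b) = (AS.act (π q) b)⁻¹ * π (γ b) * π q := fun b => by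
      rw [hq', map_mul, map_mul, map_inv, hCE.π_equiv]
    obtain ⟨s, hs⟩ := h4i _ _ (hCE.isCocycle_π hγ) (hCE.isCocycle_π hδ) ⟨π q, hπB⟩
    have hfixG := hfix _ (hCE.isCocycle_π hγ) (π q * s⁻¹) (fun b => by
      have h := (hπB b).symm.trans (hs b)
      have h' : π q = (π (γ b))⁻¹ * AS.act (π q) b * ((AS.act s b)⁻¹ * π (γ b) * s) := by
        rw [← h]; group
      rw [AS.act_map_mul, AS.act_inv]
      nth_rewrite 2 [h']
      group)
    have hπ : ∀ g, π (δ g) = π ((AQ.act q g)⁻¹ * γ g * q) := fun g => by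
      have h := hfixG g
      rw [AS.act_map_mul, AS.act_inv, eq_mul_inv_iff_mul_eq] at h
      rw [show π (δ g) = (AS.act s g)⁻¹ * π (γ g) * s from hs g, map_mul, map_mul, map_inv,
        hCE.π_equiv]
      nth_rewrite 2 [← h]
      group
    choose ρ hρ using fun g => hCE.exists_ι_mul (hπ g)
    have hρc : AR.IsCocycle ρ := (hCE.isCocycle_ι_mul_iff (hγ.twist q)).1
      (by simpa only [← hρ] using hδ)
    have hρB : ∀ b : B, ρ b = 1 := fun b => by
      have h := hρ b
      rw [← hq'] at h
      exact hCE.ι_inj ((right_eq_mul.1 h).trans (map_one ι).symm)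
    obtain ⟨r, hr⟩ := h2i (fun _ => 1) ρ (fun g h => by simp [AR.one_act]) hρc
      ⟨1, fun b => by simp [hρB, GAction.one_act]⟩
    refine ⟨q * ι r, fun g => ?_⟩
    rw [hρ, hr, mul_one, map_mul, AQ.act_map_mul, mul_inv_rev, map_inv, hCE.ι_equiv,
      mul_assoc (AQ.act (ι r) g)⁻¹, hCE.central]
    group
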